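/- Let F and F' be polarized rigid graphing functions (analytic near the origin of ℂ², holomorphic in each variable, satisfying the reality condition) both in prenormal form: F(z,0) ≡ 0 ≡ F(0,w), ∂_wF(z,0) ≡ z, ∂_zF(0,w) ≡ w, and the same for F'. Then there exist holomorphic f, g near 0 ∈ ℂ with f(0) = g(0) = 0, f'(0) ≠ 0 and ρ ∈ ℝ\{0} with ρ·F(z,w) + (1/2)g(z) + (1/2)ḡ(w) = F'(f(z), f̄(w)) near (0,0), if and only if there exist ρ₀ > 0 and φ ∈ ℝ such that F_{j,k} = ρ₀^{(j+k−2)/2}·e^{iφ(j−k)}·F'_{j,k} for all j ≥ 2, k ≥ 2. -/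

import Mathlib

open Complex Filter Topology ComplexConjugate

/-- Partial derivative in the first (`z`) slot. -/
noncomputable def pd1 (F : ℂ → ℂ → ℂ) : ℂ → ℂ → ℂ := fun z w => deriv (fun t => F t w) z

/-- Partial derivative in the second (`w`) slot. -/
noncomputable def pd2 (F : ℂ → ℂ → ℂ) : ℂ → ℂ → ℂ := fun z w => deriv (fun t => F z t) w

/-- Polarized rigid graphing function: analytic near the origin of `ℂ²` (hence holomorphic
in each of the two variables), and satisfying the reality condition near the origin. -/
def IsPolarizedRigid (F : ℂ → ℂ → ℂ) : Prop :=
  AnalyticAt ℂ (fun p : ℂ × ℂ => F p.1 p.2) 0 ∧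
    ∀ᶠ p : ℂ × ℂ in 𝓝 0, F p.1 p.2 = conj (F (conj p.2) (conj p.1))

/-- Taylor coefficient of `z^j w^k` in the expansion of `F` at the origin. -/
noncomputable def coeff2 (F : ℂ → ℂ → ℂ) (j k : ℕ) : ℂ :=
  (pd1^[j] (pd2^[k] F)) 0 0 / ((j.factorial : ℂ) * (k.factorial : ℂ))


/-- Prenormal form: `F(z,w) = zw + Σ_{j,k ≥ 2} F_{j,k} z^j w^k`. -/
def Prenormal2 (F : ℂ → ℂ → ℂ) : Prop :=
  (∀ᶠ z in 𝓝 (0 : ℂ), F z 0 = 0 ∧ pd2 F z 0 = z) ∧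
    (∀ᶠ w in 𝓝 (0 : ℂ), F 0 w = 0 ∧ pd1 F 0 w = w)

lemma pd1_iterate (F : ℂ → ℂ → ℂ) (n : ℕ) :
    pd1^[n] F = fun z w => iteratedDeriv n (fun t => F t w) z := by
  induction n with
  | zero => simp
  | succ n ih =>
    rw [Function.iterate_succ_apply', ih]
    funext z w
    rw [iteratedDeriv_succ, pd1]

lemma pd2_iterate (F : ℂ → ℂ → ℂ) (n : ℕ) :
    pd2^[n] F = fun z w => iteratedDeriv n (fun t => F z t) w := by
  induction n with
  | zero => simp
  | succ n ih =>
    rw [Function.iterate_succ_apply', ih]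
    funext z w
    rw [iteratedDeriv_succ, pd2]

lemma pd1_eq_fderiv {F : ℂ → ℂ → ℂ} {p : ℂ × ℂ}
    (h : DifferentiableAt ℂ (fun p : ℂ × ℂ => F p.1 p.2) p) :
    pd1 F p.1 p.2 = fderiv ℂ (fun p : ℂ × ℂ => F p.1 p.2) p (1, 0) :=
  (h.hasFDerivAt.comp_hasDerivAt (f := fun t => (t, p.2)) p.1
    ((hasDerivAt_id p.1).prodMk (hasDerivAt_const p.1 p.2))).deriv

lemma pd2_eq_fderiv {F : ℂ → ℂ → ℂ} {p : ℂ × ℂ}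
    (h : DifferentiableAt ℂ (fun p : ℂ × ℂ => F p.1 p.2) p) :
    pd2 F p.1 p.2 = fderiv ℂ (fun p : ℂ × ℂ => F p.1 p.2) p (0, 1) :=
  (h.hasFDerivAt.comp_hasDerivAt (f := fun t => (p.1, t)) p.2
    ((hasDerivAt_const p.2 p.1).prodMk (hasDerivAt_id p.2))).deriv

lemma pd1_eventuallyEq_fderiv {F : ℂ → ℂ → ℂ} {p : ℂ × ℂ}
    (h : AnalyticAt ℂ (fun p : ℂ × ℂ => F p.1 p.2) p) :
    (fun q : ℂ × ℂ => pd1 F q.1 q.2) =ᶠ[𝓝 p]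
      fun q => fderiv ℂ (fun p : ℂ × ℂ => F p.1 p.2) q (1, 0) :=
  h.eventually_analyticAt.mono fun _ hq => pd1_eq_fderiv hq.differentiableAt

lemma pd2_eventuallyEq_fderiv {F : ℂ → ℂ → ℂ} {p : ℂ × ℂ}
    (h : AnalyticAt ℂ (fun p : ℂ × ℂ => F p.1 p.2) p) :
    (fun q : ℂ × ℂ => pd2 F q.1 q.2) =ᶠ[𝓝 p]
      fun q => fderiv ℂ (fun p : ℂ × ℂ => F p.1 p.2) q (0, 1) :=
  h.eventually_analyticAt.mono fun _ hq => pd2_eq_fderiv hq.differentiableAt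

lemma AnalyticAt.fderiv_apply_const {f : ℂ × ℂ → ℂ} {p : ℂ × ℂ} (h : AnalyticAt ℂ f p)
    (v : ℂ × ℂ) : AnalyticAt ℂ (fun q => fderiv ℂ f q v) p :=
  (ContinuousLinearMap.analyticAt (ContinuousLinearMap.apply ℂ ℂ v) _).comp h.fderiv

lemma AnalyticAt.pd1 {F : ℂ → ℂ → ℂ} {p : ℂ × ℂ}
    (h : AnalyticAt ℂ (fun p : ℂ × ℂ => F p.1 p.2) p) :
    AnalyticAt ℂ (fun p : ℂ × ℂ => pd1 F p.1 p.2) p :=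
  (h.fderiv_apply_const (1, 0)).congr (pd1_eventuallyEq_fderiv h).symm

lemma AnalyticAt.pd2 {F : ℂ → ℂ → ℂ} {p : ℂ × ℂ}
    (h : AnalyticAt ℂ (fun p : ℂ × ℂ => F p.1 p.2) p) :
    AnalyticAt ℂ (fun p : ℂ × ℂ => pd2 F p.1 p.2) p :=
  (h.fderiv_apply_const (0, 1)).congr (pd2_eventuallyEq_fderiv h).symm

lemma AnalyticAt.pd2_iterate {F : ℂ → ℂ → ℂ} {p : ℂ × ℂ}
    (h : AnalyticAt ℂ (fun p : ℂ × ℂ => F p.1 p.2) p) (n : ℕ) :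
    AnalyticAt ℂ (fun p : ℂ × ℂ => (_root_.pd2^[n] F) p.1 p.2) p := by
  induction n with
  | zero => exact h
  | succ n ih =>
    rw [Function.iterate_succ_apply']
    exact ih.pd2

lemma pd1_congr {F G : ℂ → ℂ → ℂ} {p : ℂ × ℂ}
    (h : ∀ᶠ q : ℂ × ℂ in 𝓝 p, F q.1 q.2 = G q.1 q.2) :
    ∀ᶠ q : ℂ × ℂ in 𝓝 p, pd1 F q.1 q.2 = pd1 G q.1 q.2 := by
  filter_upwards [h.eventually_nhds] with q hq
  have hc : Tendsto (fun t : ℂ => (t, q.2)) (𝓝 q.1) (𝓝 q) :=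
    Continuous.tendsto (by fun_prop) q.1
  exact Filter.EventuallyEq.deriv_eq (hc.eventually hq)

lemma pd2_congr {F G : ℂ → ℂ → ℂ} {p : ℂ × ℂ}
    (h : ∀ᶠ q : ℂ × ℂ in 𝓝 p, F q.1 q.2 = G q.1 q.2) :
    ∀ᶠ q : ℂ × ℂ in 𝓝 p, pd2 F q.1 q.2 = pd2 G q.1 q.2 := by
  filter_upwards [h.eventually_nhds] with q hq
  have hc : Tendsto (fun t : ℂ => (q.1, t)) (𝓝 q.2) (𝓝 q) :=
    Continuous.tendsto (by fun_prop) q.2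
  exact Filter.EventuallyEq.deriv_eq (hc.eventually hq)

lemma pd1_iterate_congr {F G : ℂ → ℂ → ℂ} {p : ℂ × ℂ}
    (h : ∀ᶠ q : ℂ × ℂ in 𝓝 p, F q.1 q.2 = G q.1 q.2) (n : ℕ) :
    ∀ᶠ q : ℂ × ℂ in 𝓝 p, (pd1^[n] F) q.1 q.2 = (pd1^[n] G) q.1 q.2 := by
  induction n with
  | zero => exact h
  | succ n ih =>
    simp only [Function.iterate_succ_apply']
    exact pd1_congr ih

lemma pd2_iterate_congr {F G : ℂ → ℂ → ℂ} {p : ℂ × ℂ}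
    (h : ∀ᶠ q : ℂ × ℂ in 𝓝 p, F q.1 q.2 = G q.1 q.2) (n : ℕ) :
    ∀ᶠ q : ℂ × ℂ in 𝓝 p, (pd2^[n] F) q.1 q.2 = (pd2^[n] G) q.1 q.2 := by
  induction n with
  | zero => exact h
  | succ n ih =>
    simp only [Function.iterate_succ_apply']
    exact pd2_congr ih

lemma coeff2_congr {F G : ℂ → ℂ → ℂ}
    (h : ∀ᶠ q : ℂ × ℂ in 𝓝 0, F q.1 q.2 = G q.1 q.2) (j k : ℕ) :
    coeff2 F j k = coeff2 G j k := by
  have := (pd1_iterate_congr (pd2_iterate_congr h k) j).self_of_nhds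
  simp only [Prod.fst_zero, Prod.snd_zero] at this
  rw [coeff2, coeff2, this]

lemma pd1_pd2_comm {F : ℂ → ℂ → ℂ} {p : ℂ × ℂ}
    (h : AnalyticAt ℂ (fun p : ℂ × ℂ => F p.1 p.2) p) :
    pd1 (pd2 F) p.1 p.2 = pd2 (pd1 F) p.1 p.2 := by
  have hd : DifferentiableAt ℂ (fderiv ℂ fun p : ℂ × ℂ => F p.1 p.2) p :=
    h.fderiv.differentiableAt
  have hsymm : IsSymmSndFDerivAt ℂ (fun p : ℂ × ℂ => F p.1 p.2) p :=
    h.contDiffAt.isSymmSndFDerivAt (n := ⊤) le_top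
  have key (v w : ℂ × ℂ) : fderiv ℂ (fun q => fderiv ℂ (fun p : ℂ × ℂ => F p.1 p.2) q v) p w =
      fderiv ℂ (fderiv ℂ fun p : ℂ × ℂ => F p.1 p.2) p w v := by
    rw [fderiv_clm_apply hd (by fun_prop)]
    simp
  rw [pd1_eq_fderiv h.pd2.differentiableAt, pd2_eq_fderiv h.pd1.differentiableAt,
    (pd1_eventuallyEq_fderiv h).fderiv_eq, (pd2_eventuallyEq_fderiv h).fderiv_eq, key, key]
  exact hsymm _ _

lemma pd1_pd2_iterate_comm {F : ℂ → ℂ → ℂ} {p : ℂ × ℂ}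
    (h : AnalyticAt ℂ (fun p : ℂ × ℂ => F p.1 p.2) p) (n : ℕ) :
    ∀ᶠ q : ℂ × ℂ in 𝓝 p, pd1 (pd2^[n] F) q.1 q.2 = (pd2^[n] (pd1 F)) q.1 q.2 := by
  induction n with
  | zero => simp
  | succ n ih =>
    simp only [Function.iterate_succ_apply']
    filter_upwards [(h.pd2_iterate n).eventually_analyticAt, pd2_congr ih] with q hq hq'
    rw [pd1_pd2_comm hq, hq']

lemma eqOn_ball_of_iteratedDeriv_eq {f g : ℂ → ℂ} {r : ℝ}
    (hf : AnalyticOnNhd ℂ f (Metric.ball 0 r)) (hg : AnalyticOnNhd ℂ g (Metric.ball 0 r))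
    (h : ∀ n, iteratedDeriv n f 0 = iteratedDeriv n g 0) :
    Set.EqOn f g (Metric.ball 0 r) := fun z hz => by
  have hs := hasSum_taylorSeries_on_ball hf.differentiableOn hz
  simp only [h] at hs
  exact hs.unique (hasSum_taylorSeries_on_ball hg.differentiableOn hz)

/-- An analytic function of two variables is determined near the origin by its Taylor
coefficients. -/
lemma eventually_eq_of_coeff2_eq {F G : ℂ → ℂ → ℂ}
    (hF : AnalyticAt ℂ (fun p : ℂ × ℂ => F p.1 p.2) 0)
    (hG : AnalyticAt ℂ (fun p : ℂ × ℂ => G p.1 p.2) 0)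
    (h : ∀ j k, coeff2 F j k = coeff2 G j k) :
    ∀ᶠ p : ℂ × ℂ in 𝓝 0, F p.1 p.2 = G p.1 p.2 := by
  obtain ⟨r, hr, hball⟩ := Metric.eventually_nhds_iff_ball.1
    (hF.eventually_analyticAt.and hG.eventually_analyticAt)
  have hmem {z w : ℂ} (hz : z ∈ Metric.ball 0 r) (hw : w ∈ Metric.ball 0 r) :
      (z, w) ∈ Metric.ball (0 : ℂ × ℂ) r := by
    have := Set.mk_mem_prod hz hw
    rwa [ball_prod_same] at this
  have h0 : (0 : ℂ) ∈ Metric.ball 0 r := Metric.mem_ball_self hr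
  have hk (k : ℕ) : Set.EqOn (fun z => (pd2^[k] F) z 0) (fun z => (pd2^[k] G) z 0)
      (Metric.ball 0 r) := by
    refine eqOn_ball_of_iteratedDeriv_eq
      (fun z hz => ((hball _ (hmem hz h0)).1.pd2_iterate k).curry_left)
      (fun z hz => ((hball _ (hmem hz h0)).2.pd2_iterate k).curry_left) fun j => ?_
    have := h j k
    rw [coeff2, coeff2, div_left_inj' (by simp [Nat.factorial_ne_zero]), pd1_iterate, pd1_iterate] at this
    exact this
  filter_upwards [Metric.ball_mem_nhds (0 : ℂ × ℂ) hr] with p hp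
  have hp' : p.1 ∈ Metric.ball 0 r ∧ p.2 ∈ Metric.ball 0 r := by
    rwa [← Set.mem_prod, ball_prod_same]
  refine eqOn_ball_of_iteratedDeriv_eq
    (fun w hw => (hball _ (hmem hp'.1 hw)).1.curry_right)
    (fun w hw => (hball _ (hmem hp'.1 hw)).2.curry_right) (fun k => ?_) hp'.2
  have := hk k hp'.1
  simpa only [pd2_iterate] using this

lemma coeff2_const_mul_comp_mul (F : ℂ → ℂ → ℂ) (c a b : ℂ) (j k : ℕ) :
    coeff2 (fun z w => c * F (a * z) (b * w)) j k = c * (a ^ j * b ^ k) * coeff2 F j k := by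
  have h2 (k : ℕ) : pd2^[k] (fun z w => c * F (a * z) (b * w)) =
      fun z w => (c * b ^ k) * (pd2^[k] F) (a * z) (b * w) := by
    induction k with
    | zero => simp
    | succ k ih =>
      simp only [Function.iterate_succ_apply', ih]
      funext z w
      simp only [pd2, deriv_const_mul_field]
      rw [deriv_comp_mul_left b (fun t => (pd2^[k] F) (a * z) t) w, smul_eq_mul]
      ring
  have h1 (G : ℂ → ℂ → ℂ) (d : ℂ) (j : ℕ) : pd1^[j] (fun z w => d * G (a * z) (b * w)) =
      fun z w => (d * a ^ j) * (pd1^[j] G) (a * z) (b * w) := by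
    induction j with
    | zero => simp
    | succ j ih =>
      simp only [Function.iterate_succ_apply', ih]
      funext z w
      simp only [pd1, deriv_const_mul_field]
      rw [deriv_comp_mul_left a (fun t => (pd1^[j] G) t (b * w)) z, smul_eq_mul]
      ring
  simp only [coeff2, h2, h1, mul_zero]
  ring

lemma Prenormal2.coeff2_eq {F : ℂ → ℂ → ℂ} (h : Prenormal2 F)
    (hF : AnalyticAt ℂ (fun p : ℂ × ℂ => F p.1 p.2) 0) {j k : ℕ} (hjk : j < 2 ∨ k < 2) :
    coeff2 F j k = if j = 1 ∧ k = 1 then 1 else 0 := by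
  obtain ⟨hz, hw⟩ := h
  rcases (by omega : k = 0 ∨ k = 1 ∨ j = 0 ∨ j = 1) with rfl | rfl | rfl | rfl
  · have : (fun t => F t 0) =ᶠ[𝓝 0] fun _ => 0 := hz.mono fun _ h => h.1
    simp [coeff2, pd1_iterate, this.iteratedDeriv_eq]
  · have : (fun t => pd2 F t 0) =ᶠ[𝓝 0] fun t => t := hz.mono fun _ h => h.2
    simp only [coeff2, pd1_iterate, Function.iterate_one, this.iteratedDeriv_eq]
    rcases j with _ | _ | j <;> simp [iteratedDeriv_fun_id]
  · have : (fun t => F 0 t) =ᶠ[𝓝 0] fun _ => 0 := hw.mono fun _ h => h.1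
    simp [coeff2, pd2_iterate, this.iteratedDeriv_eq]
  · have : (fun t => pd1 F 0 t) =ᶠ[𝓝 0] fun t => t := hw.mono fun _ h => h.2
    have hc := (pd1_pd2_iterate_comm hF k).self_of_nhds
    simp only [Prod.fst_zero, Prod.snd_zero] at hc
    rw [coeff2, Function.iterate_one, hc, pd2_iterate]
    simp only [this.iteratedDeriv_eq]
    rcases k with _ | _ | k <;> simp [iteratedDeriv_fun_id]

lemma sqrt_mul_exp_pow_mul_conj_pow {ρ : ℝ} (hρ : 0 < ρ) (φ : ℝ) (j k : ℕ) :
    (√ρ * exp (φ * I)) ^ j * conj (√ρ * exp (φ * I)) ^ k =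
      ρ * (((ρ ^ (((j : ℝ) + (k : ℝ) - 2) / 2) : ℝ) : ℂ) *
        exp (I * ((φ : ℂ) * ((j : ℝ) - (k : ℝ))))) := by
  have hr : √ρ ^ (j + k) = ρ * ρ ^ (((j : ℝ) + (k : ℝ) - 2) / 2) := by
    rw [Real.sqrt_eq_rpow, ← Real.rpow_natCast, ← Real.rpow_mul hρ.le]
    conv_rhs => rw [← Real.rpow_one ρ, ← Real.rpow_mul hρ.le, ← Real.rpow_add hρ]
    congr 1
    push_cast
    ring
  have he : exp (φ * I) ^ j * exp (-(φ * I)) ^ k =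
      exp (I * ((φ : ℂ) * ((j : ℝ) - (k : ℝ)))) := by
    rw [← exp_nat_mul, ← exp_nat_mul, ← exp_add]
    congr 1
    push_cast
    ring
  have hc : conj (√ρ * exp (φ * I)) = √ρ * exp (-(φ * I)) := by
    rw [map_mul, conj_ofReal, ← exp_conj]
    simp
  rw [hc, ← he, ← mul_assoc, ← ofReal_mul, ← hr]
  push_cast
  ring

/-- A rigid equivalence between prenormalized hypersurfaces is linear. -/
lemma eventually_eq_of_rigid_equiv {F F' : ℂ → ℂ → ℂ}
    (hF' : AnalyticAt ℂ (fun p : ℂ × ℂ => F' p.1 p.2) 0)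
    (hpre : Prenormal2 F) (hpre' : Prenormal2 F') {f g : ℂ → ℂ} {ρ : ℝ}
    (hf : AnalyticAt ℂ f 0) (hf0 : f 0 = 0) (hg0 : g 0 = 0) (hf' : deriv f 0 ≠ 0)
    (h : ∀ᶠ p : ℂ × ℂ in 𝓝 0,
      (ρ : ℂ) * F p.1 p.2 + (1 / 2) * g p.1 + (1 / 2) * conj (g (conj p.2)) =
        F' (f p.1) (conj (f (conj p.2)))) :
    (ρ : ℂ) = deriv f 0 * conj (deriv f 0) ∧
      ∀ᶠ p : ℂ × ℂ in 𝓝 0,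
        (ρ : ℂ) * F p.1 p.2 = F' (deriv f 0 * p.1) (conj (deriv f 0) * p.2) := by
  set a := deriv f 0
  have hca : conj a ≠ 0 := (map_ne_zero _).2 hf'
  have hftend : Tendsto f (𝓝 0) (𝓝 0) := by
    simpa [hf0] using hf.continuousAt.tendsto
  have hconj : Tendsto (conj : ℂ → ℂ) (𝓝 0) (𝓝 0) := by
    simpa using continuous_conj.tendsto (0 : ℂ)
  have hincl : Tendsto (fun z : ℂ => (z, (0 : ℂ))) (𝓝 0) (𝓝 0) :=
    Continuous.tendsto (by fun_prop) 0
  have hg : ∀ᶠ z in 𝓝 (0 : ℂ), g z = 0 := by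
    filter_upwards [hincl.eventually h, hpre.1, hftend.eventually hpre'.1] with z hz h1 h2
    simpa [hg0, hf0, h1.1, h2.1] using hz
  have hfbar : HasDerivAt (fun w => conj (f (conj w))) (conj a) 0 := by
    have := hf.differentiableAt.hasDerivAt.conj_conj
    rwa [map_zero] at this
  have hlin : ∀ᶠ z in 𝓝 (0 : ℂ), f z * conj a = ρ * z := by
    filter_upwards [hincl.eventually h.eventually_nhds, hpre.1, hftend.eventually hpre'.1, hg,
      (hincl.comp hftend).eventually hF'.eventually_analyticAt] with z hz h1 h2 hgz han
    have hw : (fun w => (ρ : ℂ) * F z w) =ᶠ[𝓝 0] fun w => F' (f z) (conj (f (conj w))) := by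
      have hi : Tendsto (fun w : ℂ => (z, w)) (𝓝 0) (𝓝 (z, 0)) :=
        Continuous.tendsto (by fun_prop) 0
      filter_upwards [hi.eventually hz, hconj.eventually hg] with w hw hgw
      simpa [hgz, hgw] using hw
    have hd : HasDerivAt (fun t => F' (f z) t) (f z) (conj (f (conj 0))) := by
      rw [map_zero, hf0, map_zero]
      have := AnalyticAt.curry_right (p := (f z, (0 : ℂ))) han |>.differentiableAt.hasDerivAt
      dsimp only at this
      rwa [show deriv (fun t => F' (f z) t) 0 = f z from h2.2] at this
    have hR := (hd.comp (0 : ℂ) hfbar).deriv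
    have hL : deriv (fun w => (ρ : ℂ) * F z w) 0 = ρ * z := by
      rw [deriv_const_mul_field, show deriv (fun t => F z t) 0 = z from h1.2]
    rw [← hL, hw.deriv_eq]
    exact hR.symm
  have hρ : (ρ : ℂ) = a * conj a := by
    have h1 : deriv (fun z => f z * conj a) 0 = deriv (fun z => (ρ : ℂ) * z) 0 :=
      Filter.EventuallyEq.deriv_eq hlin
    rw [deriv_mul_const_field, deriv_const_mul_id] at h1
    exact h1.symm
  have hfa : ∀ᶠ z in 𝓝 (0 : ℂ), f z = a * z := by
    filter_upwards [hlin] with z hz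
    refine mul_right_cancel₀ hca ?_
    rw [hz, hρ]
    ring
  have hfst : Tendsto (fun p : ℂ × ℂ => p.1) (𝓝 0) (𝓝 0) := continuous_fst.tendsto 0
  have hsnd : Tendsto (fun p : ℂ × ℂ => conj p.2) (𝓝 0) (𝓝 0) :=
    hconj.comp (continuous_snd.tendsto 0)
  refine ⟨hρ, ?_⟩
  filter_upwards [h, hfst.eventually hg, hfst.eventually hfa, hsnd.eventually hg,
    hsnd.eventually hfa] with p hp h1 h2 h3 h4
  simpa [h1, h2, h3, h4] using hp

/-- two prenormalized rigid hypersurfaces in `ℂ²` are rigidly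
biholomorphically equivalent iff their Taylor coefficients match up to the action
`F_{j,k} = ρ₀^{(j+k−2)/2}·e^{iφ(j−k)}·F'_{j,k}` of the scaling-rotation group. -/
theorem stmt6
    (F F' : ℂ → ℂ → ℂ) (hF : IsPolarizedRigid F) (hF' : IsPolarizedRigid F')
    (hpre : Prenormal2 F) (hpre' : Prenormal2 F') :
    (∃ f g : ℂ → ℂ, ∃ ρ : ℝ,
        AnalyticAt ℂ f 0 ∧ AnalyticAt ℂ g 0 ∧ f 0 = 0 ∧ g 0 = 0 ∧
        deriv f 0 ≠ 0 ∧ ρ ≠ 0 ∧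
        ∀ᶠ p : ℂ × ℂ in 𝓝 0,
          (ρ : ℂ) * F p.1 p.2 + (1 / 2) * g p.1 + (1 / 2) * conj (g (conj p.2)) =
            F' (f p.1) (conj (f (conj p.2)))) ↔
      (∃ ρ₀ : ℝ, 0 < ρ₀ ∧ ∃ φ : ℝ, ∀ j k : ℕ, 2 ≤ j → 2 ≤ k →
        coeff2 F j k =
          ((ρ₀ ^ (((j : ℝ) + (k : ℝ) - 2) / 2) : ℝ) : ℂ) *
            Complex.exp (Complex.I * ((φ : ℂ) * ((j : ℝ) - (k : ℝ)))) *
            coeff2 F' j k) := by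
  constructor
  · rintro ⟨f, g, ρ, hf, -, hf0, hg0, hf', hρ0, h⟩
    obtain ⟨hρ, hlin⟩ := eventually_eq_of_rigid_equiv hF'.1 hpre hpre' hf hf0 hg0 hf' h
    have hnorm : ρ = ‖deriv f 0‖ ^ 2 := by
      rw [mul_conj, normSq_eq_norm_sq] at hρ
      exact_mod_cast hρ
    have hpos : 0 < ρ := by
      rw [hnorm]
      exact pow_pos (norm_pos_iff.2 hf') 2
    have ha : √ρ * exp (arg (deriv f 0) * I) = deriv f 0 := by
      rw [hnorm, Real.sqrt_sq (norm_nonneg _), norm_mul_exp_arg_mul_I]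
    refine ⟨ρ, hpos, arg (deriv f 0), fun j k _ _ => ?_⟩
    have hL := coeff2_const_mul_comp_mul F ρ 1 1 j k
    have hR := coeff2_const_mul_comp_mul F' 1 (deriv f 0) (conj (deriv f 0)) j k
    have hp := sqrt_mul_exp_pow_mul_conj_pow hpos (arg (deriv f 0)) j k
    rw [ha] at hp
    simp only [one_mul, one_pow, mul_one] at hL hR
    rw [coeff2_congr (F := fun z w => ρ * F z w)
      (G := fun z w => F' (deriv f 0 * z) (conj (deriv f 0) * w)) hlin, hR, hp, mul_assoc] at hL
    exact (mul_left_cancel₀ (ofReal_ne_zero.2 hρ0) hL).symm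
  · rintro ⟨ρ, hρ, φ, h⟩
    set a : ℂ := √ρ * exp (φ * I) with ha
    have ha0 : a ≠ 0 :=
      mul_ne_zero (ofReal_ne_zero.2 (Real.sqrt_pos.2 hρ).ne') (exp_ne_zero _)
    refine ⟨fun z => a * z, 0, ρ, by fun_prop, analyticAt_const, mul_zero a, rfl, ?_, hρ.ne', ?_⟩
    · rwa [deriv_const_mul_id]
    · have han : AnalyticAt ℂ (fun p : ℂ × ℂ => F' (a * p.1) (conj a * p.2)) 0 := by
        refine AnalyticAt.comp_of_eq (g := fun p : ℂ × ℂ => F' p.1 p.2)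
          (f := fun p : ℂ × ℂ => (a * p.1, conj a * p.2)) hF'.1
          ((analyticAt_const.mul analyticAt_fst).prod (analyticAt_const.mul analyticAt_snd))
          (by simp)
      have key := eventually_eq_of_coeff2_eq (F := fun z w => ρ * F z w)
        (G := fun z w => F' (a * z) (conj a * w)) (analyticAt_const.mul hF.1) han fun j k => by
          have hL := coeff2_const_mul_comp_mul F ρ 1 1 j k
          have hR := coeff2_const_mul_comp_mul F' 1 a (conj a) j k
          simp only [one_mul, one_pow, mul_one] at hL hR
          rw [hL, hR, ha, sqrt_mul_exp_pow_mul_conj_pow hρ, mul_assoc]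
          congr 1
          by_cases hjk : j < 2 ∨ k < 2
          · rw [hpre.coeff2_eq hF.1 hjk, hpre'.coeff2_eq hF'.1 hjk]
            split_ifs with h1
            · obtain ⟨rfl, rfl⟩ := h1
              norm_num
            · simp
          · exact h j k (by omega) (by omega)
      filter_upwards [key] with p hp
      simpa using hp
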